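/- Let a,m,b>0 satisfy max{9b/2, 4b+1/b} < a/m < 9b/2 + 2/b, and let U₂ be the vegetated steady-state value. Then the inequality ∫_{U₂}^{9bm/2} (u − 2mb + √(u² − 4umb))/(2b²) du > (1/2)(a − U₂)² holds if and only if 3/2 − log 2 + (U₂/(2m²))(a − U₂) + log((b/m)(a − U₂)) − (b/m)(a − U₂) > ((2b² + 1)/(2m²))(a − U₂)². -/

import Mathlib

open Real MeasureTheory Set

lemma spot_integral (m b y : ℝ) (hm : 0 < m) (hb : 0 < b) (hy : 1/b ≤ y) :
    ∫ s in (m*(1/y+2*b+b^2*y))..(9*b*m/2), (s - 2*m*b + Real.sqrt (s^2 - 4*s*m*b)) / (2*b^2)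
      = m^2 * (2 - Real.log 2 + Real.log (b*y) - b^2*y^2/2) := by
  have hb1 : 0 < 1/b := by positivity
  have hy0 : 0 < y := lt_of_lt_of_le hb1 hy
  have hge : ∀ t ∈ uIcc y (2/b), 1/b ≤ t := by
    intro t ht
    have h2 : 1/b ≤ 2/b := by gcongr; norm_num
    exact le_trans (le_min hy h2) ht.1
  have hder : ∀ t ∈ uIcc y (2/b),
      HasDerivAt (fun t : ℝ => m*(1/t+2*b+b^2*t)) (m*(-1/t^2+b^2)) t := by
    intro t ht
    have ht0 : t ≠ 0 := (lt_of_lt_of_le hb1 (hge t ht)).ne'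
    have h1 : HasDerivAt (fun t : ℝ => 1/t) (-1/t^2) t := by
      have := hasDerivAt_inv ht0
      simpa [one_div, neg_div] using this
    have h2 : HasDerivAt (fun t : ℝ => b^2*t) (b^2) t := by
      simpa using (hasDerivAt_id t).const_mul (b^2)
    exact ((h1.add_const (2*b)).add h2).const_mul m
  have hcont : ContinuousOn (fun t : ℝ => m*(-1/t^2+b^2)) (uIcc y (2/b)) := by
    apply ContinuousOn.mul continuousOn_const
    apply ContinuousOn.add _ continuousOn_const
    apply ContinuousOn.div continuousOn_const (by fun_prop)
    intro t ht
    have ht0 : 0 < t := lt_of_lt_of_le hb1 (hge t ht)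
    positivity
  have key := intervalIntegral.integral_comp_mul_deriv (a := y) (b := 2/b)
    (g := fun s : ℝ => (s - 2*m*b + Real.sqrt (s^2 - 4*s*m*b)) / (2*b^2)) hder hcont (by fun_prop)
  have he : m*(1/(2/b)+2*b+b^2*(2/b)) = 9*b*m/2 := by field_simp; ring
  simp only [he] at key
  rw [← key]
  have hF : ∀ t ∈ uIcc y (2/b), HasDerivAt (fun t : ℝ => m^2*(-Real.log t + b^2*t^2/2))
      (m*t*(m*(-1/t^2+b^2))) t := by
    intro t ht
    have ht0 : t ≠ 0 := (lt_of_lt_of_le hb1 (hge t ht)).ne'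
    have h1 := (Real.hasDerivAt_log ht0).neg
    have h2 := (((hasDerivAt_id t).pow 2).const_mul (b^2)).div_const 2
    have h3 := (h1.add h2).const_mul (m^2)
    refine h3.congr_deriv ?_
    simp
    field_simp
  have hI := intervalIntegral.integral_eq_sub_of_hasDerivAt hF
    (ContinuousOn.intervalIntegrable (ContinuousOn.mul (by fun_prop) hcont))
  have hcongr : ∫ x in y..(2/b), ((fun s : ℝ => (s - 2*m*b + Real.sqrt (s^2 - 4*s*m*b)) / (2*b^2)) ∘
      (fun t : ℝ => m*(1/t+2*b+b^2*t))) x * (m*(-1/x^2+b^2))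
      = ∫ t in y..(2/b), m*t*(m*(-1/t^2+b^2)) := by
    apply intervalIntegral.integral_congr
    intro t ht
    have hg := hge t ht
    have ht0 : 0 < t := lt_of_lt_of_le hb1 hg
    have hbt : 1 ≤ b*t := by
      rw [div_le_iff₀ hb] at hg; linarith
    have hnn : 0 ≤ m*(b^2*t - 1/t) := by
      apply mul_nonneg hm.le
      rw [sub_nonneg, div_le_iff₀ ht0]
      nlinarith
    have hs : (m*(1/t+2*b+b^2*t))^2 - 4*(m*(1/t+2*b+b^2*t))*m*b = (m*(b^2*t - 1/t))^2 := by
      field_simp; ring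
    simp only [Function.comp]
    rw [hs, Real.sqrt_sq hnn]
    congr 1
    field_simp; ring
  rw [hcongr, hI, Real.log_div two_ne_zero hb.ne', Real.log_mul hb.ne' hy0.ne']
  field_simp
  ring

/-- Equivalence of the integral spot-existence condition (1.4) with the
explicit inequality (1.5) of the paper. -/
theorem spot_condition_equivalence
    (a m b : ℝ) (ha : 0 < a) (hm : 0 < m) (hb : 0 < b)
    (hparam₁ : max (9*b/2) (4*b + 1/b) < a/m) (hparam₂ : a/m < 9*b/2 + 2/b)
    (V₂ : ℝ) (hV₂ : V₂ = (a/m + Real.sqrt ((a/m)^2 - 4*(1 + a*b/m))) / (2*(1 + a*b/m)))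
    (U₂ : ℝ) (hU₂ : U₂ = m * (a/m - V₂ / (1 - b*V₂))) :
    ((1/2) * (a - U₂)^2
        < ∫ s in U₂..(9*b*m/2), (s - 2*m*b + Real.sqrt (s^2 - 4*s*m*b)) / (2*b^2))
      ↔
    ((2*b^2 + 1)/(2*m^2) * (a - U₂)^2
        < 3/2 - Real.log 2 + (U₂/(2*m^2)) * (a - U₂)
          + Real.log ((b/m) * (a - U₂)) - (b/m) * (a - U₂)) := by
  have h1 : 4*b + 1/b < a/m := lt_of_le_of_lt (le_max_right _ _) hparam₁
  have hA0 : 0 < a/m := by positivity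
  have haA : a = m*(a/m) := by field_simp
  have hab : a*b/m = (a/m)*b := by ring
  rw [hab] at hV₂
  generalize a/m = A at *
  subst haA
  have hx : 4*b^2+1 < A*b := by
    have := mul_lt_mul_of_pos_right h1 hb
    have e : (4*b+1/b)*b = 4*b^2+1 := by field_simp
    linarith
  have hAb : 0 < A*b := by positivity
  have hD1 : 1 < b^2*(A^2 - 4*(1+A*b)) := by
    nlinarith [mul_pos (sub_pos.2 hx) (by positivity : 0 < A*b+1)]
  have hD : 0 < A^2 - 4*(1+A*b) := by
    by_contra h
    nlinarith [mul_nonneg (sq_nonneg b) (neg_nonneg.2 (not_lt.1 h))]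
  set S := Real.sqrt (A^2 - 4*(1+A*b)) with hS
  have hS0 : 0 < S := Real.sqrt_pos.2 hD
  have hSS : S^2 = A^2 - 4*(1+A*b) := Real.sq_sqrt hD.le
  have hbS : 1 < b*S := by
    have : 1 < (b*S)^2 := by rw [mul_pow, hSS]; exact hD1
    by_contra h
    have h0 : 0 < b*S := by positivity
    nlinarith [not_lt.1 h]
  have hSA : S < A := by nlinarith
  have hV : 2*(1+A*b)*V₂ = A + S := by rw [hV₂]; field_simp
  have hquad : (1+A*b)*V₂^2 - A*V₂ + 1 = 0 := by
    have : 4*(1+A*b)*((1+A*b)*V₂^2 - A*V₂ + 1) = 0 := by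
      have : (2*(1+A*b)*V₂ - A)^2 = S^2 := by rw [hV]; ring
      rw [hSS] at this
      linarith
    have h4 : 4*(1+A*b) ≠ 0 := by positivity
    exact (mul_eq_zero.1 this).resolve_left h4
  have hV1 : 0 < 1 - b*V₂ := by
    have : 0 < 2*(1+A*b)*(1-b*V₂) := by nlinarith
    exact pos_of_mul_pos_right this (by positivity)
  have hV2 : 0 < 2*b*V₂ - 1 := by
    have : 0 < (1+A*b)*(2*b*V₂-1) := by nlinarith
    exact pos_of_mul_pos_right this (by positivity)
  obtain ⟨y, hy⟩ : ∃ y, y = V₂/(1-b*V₂) := ⟨_, rfl⟩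
  rw [← hy] at hU₂
  have hyV : y*(1-b*V₂) = V₂ := by rw [hy]; exact div_mul_cancel₀ _ hV1.ne'
  have hyb : 1/b ≤ y := by
    rw [hy, div_le_div_iff₀ hb hV1]; linarith
  have hy0 : 0 < y := lt_of_lt_of_le (by positivity) hyb
  have hVy : V₂ = y/(1+b*y) := by
    have : 0 < 1+b*y := by positivity
    rw [eq_div_iff this.ne']; linarith
  have hAy : (1+b*y)^2 = (A-y)*y := by
    have h0 : 0 < 1+b*y := by positivity
    rw [hVy] at hquad
    field_simp at hquad
    linarith
  have hAu : A - y = 1/y+2*b+b^2*y := by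
    field_simp; linarith
  have hU : U₂ = m*(1/y+2*b+b^2*y) := by rw [hU₂, hAu]
  have hmy : m*A - U₂ = m*y := by rw [hU₂]; ring
  have e1 : b/m*(m*y) = b*y := by field_simp
  have e2 : U₂/(2*m^2)*(m*y) = (1+b*y)^2/2 := by
    rw [hAy, hU₂]; field_simp
  have e3 : (2*b^2+1)/(2*m^2)*(m*y)^2 = (2*b^2+1)/2*y^2 := by field_simp
  have hint := spot_integral m b y hm hb hyb
  rw [← hU] at hint
  rw [hint, hmy, e1, e2, e3]
  have e4 : 1/2*(m*y)^2 = m^2*(y^2/2) := by ring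
  rw [e4, mul_lt_mul_iff_right₀ (by positivity : 0 < m^2)]
  constructor <;> intro h <;> linarith
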